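/- Let α be a quadratic irrational in (0,1), c_α the characteristic Sturmian word of slope α, and let x be obtained from c_α by replacing 0's by a periodic sequence y of period p and 1's by a periodic sequence y' of period p'. Then x is automatic with respect to the Ostrowski α-numeration system. -/

import Mathlib

/-- Standard words associated to the continued fraction `[0; d 1, d 2, ...]`. -/
def stdWord (d : ℕ → ℕ) : ℕ → List ℕ
  | 0 => [0]
  | 1 => List.replicate (d 1 - 1) 0 ++ [1]
  | (n+2) => (List.replicate (d (n+2)) (stdWord d (n+1))).flatten ++ stdWord d n

/-- Auxiliary numerators: `pAux d (n+2) = p_n` with `p_{-2} = 0`, `p_{-1} = 1`. -/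
def pAux (d : ℕ → ℕ) : ℕ → ℕ
  | 0 => 0
  | 1 => 1
  | (n+2) => d n * pAux d (n+1) + pAux d n

/-- Auxiliary denominators: `qAux d (n+2) = q_n` with `q_{-2} = 1`, `q_{-1} = 0`. -/
def qAux (d : ℕ → ℕ) : ℕ → ℕ
  | 0 => 1
  | 1 => 0
  | (n+2) => d n * qAux d (n+1) + qAux d n

/-- The numerator `p_n` of the `n`-th convergent of `[d 0; d 1, d 2, ...]`. -/
def pconv (d : ℕ → ℕ) (n : ℕ) : ℕ := pAux d (n+2)

/-- The denominator `q_n` of the `n`-th convergent of `[d 0; d 1, d 2, ...]`. -/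
def qconv (d : ℕ → ℕ) (n : ℕ) : ℕ := qAux d (n+2)

/-- The characteristic Sturmian word of slope `[0; d 1, d 2, ...]`
(the limit of the standard words). -/
def charWord (d : ℕ → ℕ) (n : ℕ) : ℕ := (stdWord d (n+1)).getD n 0

/-- Number of occurrences of the letter `a` among `x 0, ..., x (n-1)`. -/
def countBelow (x : ℕ → ℕ) (a n : ℕ) : ℕ :=
  ((Finset.range n).filter fun j => x j = a).card

/-- The value of an Ostrowski digit string (least-significant digit first)
with respect to the denominators `q`. -/
def ostVal (q : ℕ → ℕ) (b : List ℕ) : ℕ :=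
  ∑ i ∈ Finset.range b.length, b.getD i 0 * q i

/-- The digit string `b` (least-significant first) is a valid Ostrowski
`α`-representation for the continued fraction `[0; d 1, d 2, ...]`. -/
def ValidOst (d : ℕ → ℕ) (b : List ℕ) : Prop :=
  b.getD 0 0 < d 1 ∧
  (∀ i : ℕ, 1 ≤ i → i < b.length → b.getD i 0 ≤ d (i + 1)) ∧
  (∀ i : ℕ, 1 ≤ i → i < b.length → b.getD i 0 = d (i + 1) → b.getD (i - 1) 0 = 0)

/-- `α` is a quadratic irrational. -/
def QuadraticIrrational (α : ℝ) : Prop :=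
  Irrational α ∧ ∃ A B C : ℤ, A ≠ 0 ∧ (A : ℝ) * α ^ 2 + (B : ℝ) * α + (C : ℝ) = 0


/-- A sequence generated by iterating a map on a finite set. -/
def FiniteOrbit {X : Type} (g : ℕ → X) : Prop :=
  ∃ (I : Type) (_ : Fintype I) (i0 : I) (next : I → I) (f : I → X),
    ∀ n, f (next^[n] i0) = g n

theorem finiteOrbit_of_finite_range {X : Type} (g : ℕ → X) (G : X → X)
    (hG : ∀ n, g (n + 1) = G (g n)) (hfin : (Set.range g).Finite) : FiniteOrbit g := by
  have hmem : ∀ t : Set.range g, G t.1 ∈ Set.range g := by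
    rintro ⟨_, n, rfl⟩
    exact ⟨n + 1, hG n⟩
  refine ⟨Set.range g, hfin.fintype, ⟨g 0, 0, rfl⟩, fun t => ⟨G t.1, hmem t⟩, Subtype.val, ?_⟩
  intro n
  induction n with
  | zero => rfl
  | succ n ih => rw [Function.iterate_succ_apply', hG, ← ih]

theorem FiniteOrbit.map {X Y : Type} {g : ℕ → X} (hg : FiniteOrbit g) (F : X → Y) :
    FiniteOrbit (fun n => F (g n)) := by
  obtain ⟨I, hI, i0, next, f, h⟩ := hg
  exact ⟨I, hI, i0, next, F ∘ f, fun n => by simp [h]⟩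

theorem FiniteOrbit.linear_recurrence {d : ℕ → ℕ} (hd : FiniteOrbit d) {m : ℕ} [NeZero m]
    (u : ℕ → ZMod m) (hu : ∀ n, u (n + 2) = d (n + 2) * u (n + 1) + u n) : FiniteOrbit u := by
  obtain ⟨I, hI, i0, next, f, h⟩ := hd
  refine ⟨I × ZMod m × ZMod m, inferInstance, (i0, u 0, u 1),
    fun s => (next s.1, s.2.2, f (next (next s.1)) * s.2.2 + s.2.1), fun s => s.2.1, ?_⟩
  have key : ∀ n, (fun s : I × ZMod m × ZMod m =>
      (next s.1, s.2.2, (f (next (next s.1)) : ZMod m) * s.2.2 + s.2.1))^[n] (i0, u 0, u 1)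
      = (next^[n] i0, u n, u (n + 1)) := by
    intro n
    induction n with
    | zero => rfl
    | succ n ih =>
      rw [Function.iterate_succ_apply', ih, hu n, ← h (n + 2)]
      simp only [Function.iterate_succ_apply']
  intro n
  rw [key]

/-- A function of digit strings computed by a finite automaton reading from left to right. -/
def IsAutomatic {X : Type} (F : List ℕ → X) : Prop :=
  ∃ (Q : Type) (_ : Fintype Q) (δ : Q → ℕ → Q) (q0 : Q) (out : Q → X),
    ∀ b : List ℕ, out (b.foldl δ q0) = F b

theorem IsAutomatic.map {X Y : Type} {F : List ℕ → X} (hF : IsAutomatic F) (G : X → Y) :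
    IsAutomatic (fun b => G (F b)) := by
  obtain ⟨Q, hQ, δ, q0, out, h⟩ := hF
  exact ⟨Q, hQ, δ, q0, G ∘ out, fun b => by simp [h]⟩

theorem IsAutomatic.prod {X Y : Type} {F : List ℕ → X} {G : List ℕ → Y} (hF : IsAutomatic F)
    (hG : IsAutomatic G) : IsAutomatic (fun b => (F b, G b)) := by
  obtain ⟨Q, hQ, δ, q0, out, h⟩ := hF
  obtain ⟨Q', hQ', δ', q0', out', h'⟩ := hG
  refine ⟨Q × Q', inferInstance, fun s a => (δ s.1 a, δ' s.2 a), (q0, q0'),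
    fun s => (out s.1, out' s.2), fun b => ?_⟩
  have key : ∀ (b : List ℕ) (s : Q) (s' : Q'),
      b.foldl (fun (s : Q × Q') a => (δ s.1 a, δ' s.2 a)) (s, s')
        = (b.foldl δ s, b.foldl δ' s') := by
    intro b
    induction b with
    | nil => intros; rfl
    | cons a b ih => intro s s'; simp [ih]
  simp only [key, h, h']

theorem IsAutomatic.comp_tail {X : Type} {F : List ℕ → X} (hF : IsAutomatic F) :
    IsAutomatic (fun b => F b.tail) := by
  obtain ⟨Q, hQ, δ, q0, out, h⟩ := hF
  refine ⟨Option Q, inferInstance, fun s a => some (s.elim q0 fun q => δ q a), none,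
    fun s => out (s.getD q0), fun b => ?_⟩
  have key : ∀ (b : List ℕ) (s : Q),
      b.foldl (fun (s : Option Q) a => some (s.elim q0 fun q => δ q a)) (some s)
        = some (b.foldl δ s) := by
    intro b
    induction b with
    | nil => intros; rfl
    | cons a b ih => intro s; simp [ih]
  cases b with
  | nil => simpa using h []
  | cons a b => simpa [key] using h b

theorem isAutomatic_digit_eq (c i : ℕ) :
    IsAutomatic (fun b => decide (b.getD i 0 = c)) := by
  induction i with
  | zero =>
    refine ⟨Option Bool, inferInstance, fun s a => some (s.getD (decide (a = c))), none,
      fun s => s.getD (decide (0 = c)), fun b => ?_⟩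
    have key : ∀ (b : List ℕ) (t : Bool),
        b.foldl (fun (s : Option Bool) a => some (s.getD (decide (a = c)))) (some t)
          = some t := by
      intro b t
      induction b with
      | nil => rfl
      | cons a b ih => simpa using ih
    cases b with
    | nil => simp
    | cons a b => simp [key]
  | succ i ih =>
    convert ih.comp_tail using 3 with b
    cases b <;> simp

theorem FiniteOrbit.isAutomatic_sum {m : ℕ} [NeZero m] {v : ℕ → ZMod m} (hv : FiniteOrbit v) :
    IsAutomatic (fun b => ∑ i ∈ Finset.range b.length, (b.getD i 0 : ZMod m) * v i) := by
  obtain ⟨I, hI, i0, next, f, h⟩ := hv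
  refine ⟨I × ZMod m, inferInstance, fun s a => (next s.1, s.2 + a * f s.1), (i0, 0),
    fun s => s.2, fun b => ?_⟩
  have key : b.foldl (fun (s : I × ZMod m) (a : ℕ) => (next s.1, s.2 + a * f s.1)) (i0, 0)
      = (next^[b.length] i0, ∑ i ∈ Finset.range b.length, (b.getD i 0 : ZMod m) * v i) := by
    induction b using List.reverseRecOn with
    | nil => rfl
    | append_singleton b a ih =>
      rw [List.foldl_append, ih]
      simp only [List.foldl_cons, List.foldl_nil, List.length_append, List.length_singleton,
        Function.iterate_succ_apply', Finset.sum_range_succ, h]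
      congr 2
      · refine Finset.sum_congr rfl fun i hi => ?_
        rw [List.getD_append _ _ _ _ (Finset.mem_range.1 hi)]
      · simp
  rw [key]

section Words

variable {d : ℕ → ℕ}

theorem stdWord_prefix_succ (k : ℕ) (hd : 1 ≤ d (k + 2)) :
    stdWord d (k + 1) <+: stdWord d (k + 2) := by
  obtain ⟨m, hm⟩ := Nat.exists_eq_add_of_le' hd
  rw [stdWord, hm, List.replicate_succ, List.flatten_cons, List.append_assoc]
  exact List.prefix_append _ _

theorem stdWord_prefix_stdWord (hd : ∀ i, 1 ≤ d (i + 1)) {k l : ℕ} (h : k ≤ l) :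
    stdWord d (k + 1) <+: stdWord d (l + 1) := by
  induction l, h using Nat.le_induction with
  | base => exact List.prefix_rfl
  | succ l _ ih => exact ih.trans (stdWord_prefix_succ l (hd _))

theorem length_stdWord (hd0 : d 0 = 0) (hd : ∀ i, 1 ≤ d (i + 1)) :
    ∀ k, (stdWord d k).length = qconv d k
  | 0 => by simp [stdWord, qconv, qAux]
  | 1 => by
    simpa [stdWord, qconv, qAux] using Nat.sub_add_cancel (hd 0)
  | k + 2 => by
    simp only [stdWord, List.length_append, List.length_flatten, List.map_replicate,
      List.sum_replicate, length_stdWord hd0 hd k, length_stdWord hd0 hd (k + 1)]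
    rfl

theorem succ_le_length_stdWord (hd : ∀ i, 1 ≤ d (i + 1)) :
    ∀ k, k + 1 ≤ (stdWord d (k + 1)).length ∧ 1 ≤ (stdWord d k).length
  | 0 => by simp [stdWord]
  | k + 1 => by
    obtain ⟨h1, h2⟩ := succ_le_length_stdWord hd k
    refine ⟨?_, by omega⟩
    simp only [stdWord, List.length_append, List.length_flatten, List.map_replicate,
      List.sum_replicate, smul_eq_mul]
    have := Nat.le_mul_of_pos_left (stdWord d (k + 1)).length (hd (k + 1))
    linarith

theorem charWord_eq_getD (hd : ∀ i, 1 ≤ d (i + 1)) {k i : ℕ}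
    (hi : i < (stdWord d (k + 1)).length) : charWord d i = (stdWord d (k + 1)).getD i 0 := by
  have hi' : i < (stdWord d (i + 1)).length := (succ_le_length_stdWord hd i).1
  unfold charWord
  rcases le_total i k with h | h
  · obtain ⟨t, ht⟩ := stdWord_prefix_stdWord hd h
    rw [← ht, List.getD_append _ _ _ _ hi']
  · obtain ⟨t, ht⟩ := stdWord_prefix_stdWord hd h
    rw [← ht, List.getD_append _ _ _ _ hi]

theorem countBelow_eq_count (x : ℕ → ℕ) (a : ℕ) (w : List ℕ)
    (h : ∀ i < w.length, x i = w.getD i 0) : countBelow x a w.length = w.count a := by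
  induction w using List.reverseRecOn with
  | nil => simp [countBelow]
  | append_singleton w c ih =>
    have hw : ∀ i < w.length, x i = w.getD i 0 := fun i hi => by
      rw [h i (by simp; omega), List.getD_append _ _ _ _ hi]
    have hc : x w.length = c := by rw [h _ (by simp)]; simp
    have hx := ih hw
    unfold countBelow at hx ⊢
    rw [List.length_append, List.length_singleton, Finset.range_add_one, Finset.filter_insert,
      List.count_append, hc]
    split_ifs with hca
    · rw [Finset.card_insert_of_notMem (by simp), hx]; simp [hca]
    · rw [hx]; simp [hca]

/-- The word `s_{k-1}^{b_{k-1}} ... s_0^{b_0}`. -/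
def digitWord (d b : ℕ → ℕ) : ℕ → List ℕ
  | 0 => []
  | k + 1 => (List.replicate (b k) (stdWord d k)).flatten ++ digitWord d b k

theorem length_digitWord (d b : ℕ → ℕ) (k : ℕ) :
    (digitWord d b k).length = ∑ i ∈ Finset.range k, b i * (stdWord d i).length := by
  induction k with
  | zero => rfl
  | succ k ih => simp [digitWord, Finset.sum_range_succ, ih, add_comm]

theorem count_digitWord (d b : ℕ → ℕ) (a k : ℕ) :
    (digitWord d b k).count a = ∑ i ∈ Finset.range k, b i * (stdWord d i).count a := by
  induction k with
  | zero => rfl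
  | succ k ih => simp [digitWord, Finset.sum_range_succ, ih, add_comm, List.count_flatten]

/-- The letter following the prefix with Ostrowski digits `b`. -/
def nextLetter (d b : ℕ → ℕ) : ℕ := if b 0 + 1 = d 1 ∧ b 1 ≠ d 2 then 1 else 0

theorem flatten_replicate_prefix_append {w v t : List ℕ} {m n : ℕ} (hw : w <+: v)
    (hmn : m < n) :
    (List.replicate m v).flatten ++ w <+: (List.replicate n v).flatten ++ t := by
  obtain ⟨r, rfl⟩ := Nat.exists_eq_add_of_lt hmn
  rw [show m + r + 1 = m + (r + 1) by ring, List.replicate_add, List.flatten_append,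
    List.append_assoc, List.prefix_append_right_inj, List.replicate_succ, List.flatten_cons,
    List.append_assoc]
  exact hw.trans (List.prefix_append _ _)

theorem digitWord_nextLetter_prefix_stdWord {b : ℕ → ℕ} (h0 : b 0 < d 1)
    (hle : ∀ i, b (i + 1) ≤ d (i + 2)) (hz : ∀ i, b (i + 1) = d (i + 2) → b i = 0)
    (hd : ∀ i, 1 ≤ d (i + 1)) :
    ∀ k, (k = 0 → b 1 = d 2) → (k = 1 → b 1 ≠ d 2) →
      digitWord d b k ++ [nextLetter d b] <+: stdWord d k
  | 0, h, _ => by simp [digitWord, nextLetter, h rfl, stdWord]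
  | 1, _, h => by
    have h := h rfl
    simp only [digitWord, stdWord, List.append_nil, nextLetter, h, ne_eq, not_false_eq_true,
      and_true]
    have hrep : ∀ m : ℕ, (List.replicate m [0]).flatten = List.replicate m 0 := by
      intro m
      induction m with
      | zero => rfl
      | succ m ih => simp [List.replicate_succ, ih]
    rw [hrep]
    split_ifs with hb
    · rw [← hb]; simp
    · obtain ⟨r, hr⟩ := Nat.exists_eq_add_of_lt h0
      obtain ⟨s, rfl⟩ : ∃ s, r = s + 1 := ⟨r - 1, by omega⟩
      rw [hr, show b 0 + (s + 1) + 1 - 1 = b 0 + 1 + s by omega, List.replicate_add,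
        List.replicate_add, List.append_assoc]
      exact List.prefix_append _ _
  | k + 2, _, _ => by
    rw [digitWord, List.append_assoc]
    rcases (hle k).lt_or_eq with h | h
    · refine flatten_replicate_prefix_append
        (digitWord_nextLetter_prefix_stdWord h0 hle hz hd (k + 1) (by omega) ?_) h
      intro hk
      obtain rfl : k = 0 := by omega
      exact h.ne
    · rw [stdWord, h, List.prefix_append_right_inj, digitWord, hz k h]
      simp only [List.replicate_zero, List.flatten_nil, List.nil_append]
      refine digitWord_nextLetter_prefix_stdWord h0 hle hz hd k (by rintro rfl; exact h) ?_
      rintro rfl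
      rw [hz 1 h]
      exact (Nat.one_le_iff_ne_zero.1 (hd 1)).symm

end Words

section ContinuedFraction

variable {d : ℕ → ℕ}

/-- The signed approximation error `q α - p` of the auxiliary convergents. -/
def convErr (d : ℕ → ℕ) (α : ℝ) (n : ℕ) : ℝ := qAux d n * α - pAux d n

theorem convErr_add_two (d : ℕ → ℕ) (α : ℝ) (n : ℕ) :
    convErr d α (n + 2) = d n * convErr d α (n + 1) + convErr d α n := by
  simp only [convErr, qAux, pAux]
  push_cast
  ring

theorem one_le_qAux (hd : ∀ i, 1 ≤ d (i + 1)) (n : ℕ) : 1 ≤ qAux d (n + 2) := by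
  induction n with
  | zero => simp [qAux]
  | succ n ih =>
    rw [qAux]
    exact le_add_right (Nat.mul_pos (hd n) ih)

theorem qAux_le_succ (hd : ∀ i, 1 ≤ d (i + 1)) (n : ℕ) : qAux d (n + 1) ≤ qAux d (n + 2) := by
  cases n with
  | zero => simp [qAux]
  | succ n =>
    rw [qAux.eq_3 d (n + 1)]
    exact le_add_right (Nat.le_mul_of_pos_left _ (hd n))

theorem convErr_ne_zero {α : ℝ} (hα : Irrational α) (hd : ∀ i, 1 ≤ d (i + 1)) (n : ℕ) :
    convErr d α n ≠ 0 := by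
  intro h
  unfold convErr at h
  match n with
  | 0 => simp [qAux, pAux] at h; exact hα.ne_zero h
  | 1 => simp [qAux, pAux] at h
  | n + 2 =>
    have hq : (qAux d (n + 2) : ℝ) ≠ 0 := by
      have := one_le_qAux hd n
      positivity
    apply hα
    refine ⟨(pAux d (n + 2) : ℚ) / qAux d (n + 2), ?_⟩
    push_cast
    field_simp
    linarith

theorem convErr_not_same_sign {α : ℝ} (hd : ∀ i, 1 ≤ d (i + 1))
    (hcf : Filter.Tendsto (fun n => (pconv d n : ℝ) / (qconv d n : ℝ)) Filter.atTop (nhds α))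
    (s : ℝ) (m : ℕ) (h1 : 0 < s * convErr d α m) (h2 : 0 < s * convErr d α (m + 1)) : False := by
  obtain ⟨c, hc, hc1, hc2⟩ : ∃ c : ℝ, 0 < c ∧ c * qAux d m ≤ s * convErr d α m ∧
      c * qAux d (m + 1) ≤ s * convErr d α (m + 1) := by
    refine ⟨min (s * convErr d α m / (qAux d m + 1)) (s * convErr d α (m + 1) /
      (qAux d (m + 1) + 1)), by positivity, ?_, ?_⟩
    · calc _ ≤ s * convErr d α m / (qAux d m + 1) * (qAux d m + 1) := by
            gcongr
            · exact min_le_left _ _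
            · linarith
        _ = _ := by field_simp
    · calc _ ≤ s * convErr d α (m + 1) / (qAux d (m + 1) + 1) * (qAux d (m + 1) + 1) := by
            gcongr
            · exact min_le_right _ _
            · linarith
        _ = _ := by field_simp
  have key : ∀ j, c * qAux d (m + j) ≤ s * convErr d α (m + j) ∧
      c * qAux d (m + j + 1) ≤ s * convErr d α (m + j + 1) := by
    intro j
    induction j with
    | zero => exact ⟨hc1, hc2⟩
    | succ j ih =>
      refine ⟨ih.2, ?_⟩
      rw [show m + (j + 1) + 1 = m + j + 2 by ring, convErr_add_two, qAux]
      push_cast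
      have := mul_le_mul_of_nonneg_left ih.2 (Nat.cast_nonneg (α := ℝ) (d (m + j)))
      linarith [ih.1]
  have hlim : Filter.Tendsto (fun n => s * (α - (pconv d n : ℝ) / (qconv d n : ℝ)))
      Filter.atTop (nhds (s * (α - α))) := (hcf.const_sub α).const_mul s
  have hge : c ≤ s * (α - α) := by
    refine ge_of_tendsto hlim ?_
    filter_upwards [Filter.eventually_ge_atTop m] with n hn
    have hk := (key (n + 2 - m)).1
    rw [show m + (n + 2 - m) = n + 2 by omega] at hk
    have hq : (0 : ℝ) < qAux d (n + 2) := by exact_mod_cast one_le_qAux hd n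
    have : α - (pconv d n : ℝ) / qconv d n = convErr d α (n + 2) / qAux d (n + 2) := by
      unfold pconv qconv convErr
      field_simp
    rw [this, ← mul_div_assoc, le_div_iff₀ hq]
    exact hk
  simp at hge
  linarith

theorem convErr_mul_succ_neg {α : ℝ} (hα : Irrational α) (hd : ∀ i, 1 ≤ d (i + 1))
    (hcf : Filter.Tendsto (fun n => (pconv d n : ℝ) / (qconv d n : ℝ)) Filter.atTop (nhds α))
    (n : ℕ) : convErr d α n * convErr d α (n + 1) < 0 := by
  by_contra! h
  have h1 := convErr_ne_zero hα hd n
  have h2 := convErr_ne_zero hα hd (n + 1)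
  have h := lt_of_le_of_ne h (mul_ne_zero h1 h2).symm
  exact convErr_not_same_sign hd hcf (convErr d α n) n (mul_self_pos.2 h1) h

theorem pAux_mul_qAux_sub (d : ℕ → ℕ) (n : ℕ) :
    (pAux d (n + 1) * qAux d n - pAux d n * qAux d (n + 1) : ℤ) = (-1) ^ n := by
  induction n with
  | zero => simp [pAux, qAux]
  | succ n ih =>
    rw [pAux, qAux, pow_succ, ← ih]
    push_cast
    ring

theorem convErr_bounds {α : ℝ} (hα : Irrational α) (hd : ∀ i, 1 ≤ d (i + 1))
    (hcf : Filter.Tendsto (fun n => (pconv d n : ℝ) / (qconv d n : ℝ)) Filter.atTop (nhds α))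
    (n : ℕ) : |convErr d α n * qAux d (n + 1)| ≤ 1 ∧ |convErr d α (n + 1) * qAux d n| ≤ 1 := by
  have hdet : convErr d α n * qAux d (n + 1) - convErr d α (n + 1) * qAux d n = (-1) ^ n := by
    have := congrArg (Int.cast : ℤ → ℝ) (pAux_mul_qAux_sub d n)
    push_cast at this
    rw [← this]
    unfold convErr
    ring
  have hneg := convErr_mul_succ_neg hα hd hcf n
  have hprod : (convErr d α n * qAux d (n + 1)) * (convErr d α (n + 1) * qAux d n) ≤ 0 := by
    have : (0 : ℝ) ≤ qAux d (n + 1) * qAux d n := by positivity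
    nlinarith
  have hsq : (convErr d α n * qAux d (n + 1) - convErr d α (n + 1) * qAux d n) ^ 2 = 1 := by
    rw [hdet, ← pow_mul, mul_comm, pow_mul]
    simp
  constructor <;> rw [← sq_le_one_iff_abs_le_one] <;>
    nlinarith [sq_nonneg (convErr d α n * qAux d (n + 1)),
      sq_nonneg (convErr d α (n + 1) * qAux d n)]

theorem convErr_self_bounds {α : ℝ} (hα0 : 0 < α) (hα1 : α < 1) (hα : Irrational α)
    (hd : ∀ i, 1 ≤ d (i + 1))
    (hcf : Filter.Tendsto (fun n => (pconv d n : ℝ) / (qconv d n : ℝ)) Filter.atTop (nhds α))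
    (n : ℕ) : |convErr d α n * qAux d n| ≤ 1 ∧ |convErr d α n| ≤ 1 := by
  cases n with
  | zero => simp [convErr, qAux, pAux, abs_of_pos hα0, hα1.le]
  | succ n =>
    have h := (convErr_bounds hα hd hcf (n + 1)).1
    have h1 : (1 : ℝ) ≤ qAux d (n + 2) := by exact_mod_cast one_le_qAux hd n
    have h2 : (qAux d (n + 1) : ℝ) ≤ qAux d (n + 2) := by exact_mod_cast qAux_le_succ hd n
    rw [abs_mul, Nat.abs_cast] at h ⊢
    constructor
    · exact (mul_le_mul_of_nonneg_left h2 (abs_nonneg _)).trans h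
    · exact (le_mul_of_one_le_right (abs_nonneg _) h1).trans h

/-- The complete quotients of the continued fraction of `α`. -/
noncomputable def completeQuotient (d : ℕ → ℕ) (α : ℝ) (n : ℕ) : ℝ :=
  -convErr d α n / convErr d α (n + 1)

theorem completeQuotient_sub_inv {α : ℝ} (hα : Irrational α) (hd : ∀ i, 1 ≤ d (i + 1)) (n : ℕ) :
    completeQuotient d α (n + 1) = (completeQuotient d α n - d n)⁻¹ := by
  have h1 := convErr_ne_zero hα hd (n + 1)
  have h2 := convErr_ne_zero hα hd (n + 2)
  have h : completeQuotient d α n - d n = -convErr d α (n + 2) / convErr d α (n + 1) := by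
    rw [completeQuotient, convErr_add_two]
    field_simp
    ring
  rw [h, completeQuotient, inv_div, div_neg, neg_div]

theorem completeQuotient_pos {α : ℝ} (hα : Irrational α) (hd : ∀ i, 1 ≤ d (i + 1))
    (hcf : Filter.Tendsto (fun n => (pconv d n : ℝ) / (qconv d n : ℝ)) Filter.atTop (nhds α))
    (n : ℕ) : 0 < completeQuotient d α n := by
  have h := convErr_mul_succ_neg hα hd hcf n
  have h1 := convErr_ne_zero hα hd (n + 1)
  have : completeQuotient d α n
      = -(convErr d α n * convErr d α (n + 1)) / convErr d α (n + 1) ^ 2 := by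
    rw [completeQuotient]
    field_simp
  rw [this]
  have : 0 < -(convErr d α n * convErr d α (n + 1)) := by linarith
  positivity

theorem floor_completeQuotient {α : ℝ} (hα : Irrational α) (hd : ∀ i, 1 ≤ d (i + 1))
    (hcf : Filter.Tendsto (fun n => (pconv d n : ℝ) / (qconv d n : ℝ)) Filter.atTop (nhds α))
    (n : ℕ) : ⌊completeQuotient d α n⌋₊ = d n := by
  have hlt : ∀ n, (d n : ℝ) < completeQuotient d α n := fun n => by
    have h := completeQuotient_pos hα hd hcf (n + 1)
    rw [completeQuotient_sub_inv hα hd, inv_pos] at h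
    linarith
  have h1 : 1 < completeQuotient d α (n + 1) :=
    lt_of_le_of_lt (by exact_mod_cast hd n) (hlt (n + 1))
  rw [completeQuotient_sub_inv hα hd, one_lt_inv₀ (sub_pos.2 (hlt n))] at h1
  rw [Nat.floor_eq_iff (completeQuotient_pos hα hd hcf n).le]
  exact ⟨(hlt n).le, by linarith⟩

theorem finite_range_completeQuotient {α : ℝ} (hα0 : 0 < α) (hα1 : α < 1)
    (hquad : QuadraticIrrational α) (hd : ∀ i, 1 ≤ d (i + 1))
    (hcf : Filter.Tendsto (fun n => (pconv d n : ℝ) / (qconv d n : ℝ)) Filter.atTop (nhds α)) :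
    (Set.range (completeQuotient d α)).Finite := by
  obtain ⟨hα, A, B, C, hA, hABC⟩ := hquad
  have hdisc : B ^ 2 - 4 * A * C ≠ 0 := by
    intro h
    have hr : (B : ℝ) ^ 2 - 4 * A * C = 0 := by exact_mod_cast h
    have hsq : (2 * A * α + B) ^ 2 = 0 := by linear_combination 4 * (A : ℝ) * hABC + hr
    have hlin : 2 * A * α + B = 0 := by simpa using hsq
    have hA' : (A : ℝ) ≠ 0 := by exact_mod_cast hA
    apply hα
    refine ⟨-(B : ℚ) / (2 * A), ?_⟩
    push_cast
    field_simp
    linarith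
  set D : ℝ := |2 * A * α + B| with hD
  obtain ⟨M, hM⟩ := exists_nat_ge (2 * D + 2 * |(A : ℝ)|)
  have hD0 : 0 ≤ D := abs_nonneg _
  have hA0 : 0 ≤ |(A : ℝ)| := abs_nonneg _
  let S : Set (ℤ × ℤ × ℤ) := {t | t ∈ Set.Icc (-(M : ℤ)) M ×ˢ (Set.Icc (-(M : ℤ)) M ×ˢ
    Set.Icc (-(M : ℤ)) M) ∧ t ≠ 0}
  have hS : S.Finite := Set.Finite.subset ((Set.finite_Icc _ _).prod
    ((Set.finite_Icc _ _).prod (Set.finite_Icc _ _))) fun t ht => ht.1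
  have hroots : ∀ t ∈ S, {z : ℝ | (t.1 : ℝ) * z ^ 2 + t.2.1 * z + t.2.2 = 0}.Finite := by
    rintro ⟨a, b, c⟩ ⟨-, ht⟩
    let P : Polynomial ℝ := Polynomial.C (a : ℝ) * Polynomial.X ^ 2 +
      Polynomial.C (b : ℝ) * Polynomial.X + Polynomial.C (c : ℝ)
    have hP : P ≠ 0 := by
      intro h
      have h0 : P.eval 0 = 0 := by rw [h, Polynomial.eval_zero]
      have h1 : P.eval 1 = 0 := by rw [h, Polynomial.eval_zero]
      have h2 : P.eval (-1) = 0 := by rw [h, Polynomial.eval_zero]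
      simp only [P, Polynomial.eval_add, Polynomial.eval_mul, Polynomial.eval_pow,
        Polynomial.eval_C, Polynomial.eval_X] at h0 h1 h2
      norm_num at h0 h1 h2
      have h1' : a + b + c = 0 := by exact_mod_cast h1
      have h2' : a + -b + c = 0 := by exact_mod_cast h2
      apply ht
      rw [Prod.mk_eq_zero, Prod.mk_eq_zero]
      omega
    refine (Polynomial.finite_setOfPred_isRoot hP).subset fun z hz => ?_
    simpa [P, Polynomial.IsRoot] using hz
  refine (hS.biUnion hroots).subset ?_
  rintro _ ⟨n, rfl⟩
  have hform : ∀ k, |((A * pAux d k ^ 2 + B * pAux d k * qAux d k + C * qAux d k ^ 2 : ℤ) : ℝ)|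
      ≤ M := by
    intro k
    obtain ⟨h1, h2⟩ := convErr_self_bounds hα0 hα1 hα hd hcf k
    have heq : ((A * pAux d k ^ 2 + B * pAux d k * qAux d k + C * qAux d k ^ 2 : ℤ) : ℝ)
        = -((2 * A * α + B) * (convErr d α k * qAux d k))
          + A * (convErr d α k * convErr d α k) := by
      unfold convErr
      push_cast
      linear_combination (qAux d k : ℝ) ^ 2 * hABC
    rw [heq]
    refine (abs_add_le _ _).trans ?_
    rw [abs_neg, abs_mul, abs_mul (A : ℝ), ← hD, abs_mul (convErr d α k) (convErr d α k)]
    have h3 := mul_le_mul_of_nonneg_left h1 hD0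
    have h4 := mul_le_mul_of_nonneg_left (mul_le_one₀ h2 (abs_nonneg _) h2) hA0
    linarith
  have hbil : |((2 * A * pAux d (n + 1) * pAux d n + B * (pAux d (n + 1) * qAux d n
      + pAux d n * qAux d (n + 1)) + 2 * C * qAux d (n + 1) * qAux d n : ℤ) : ℝ)| ≤ M := by
    obtain ⟨h1, h2⟩ := convErr_bounds hα hd hcf n
    have h3 := (convErr_self_bounds hα0 hα1 hα hd hcf n).2
    have h4 := (convErr_self_bounds hα0 hα1 hα hd hcf (n + 1)).2
    have heq : ((2 * A * pAux d (n + 1) * pAux d n + B * (pAux d (n + 1) * qAux d n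
      + pAux d n * qAux d (n + 1)) + 2 * C * qAux d (n + 1) * qAux d n : ℤ) : ℝ)
        = -((2 * A * α + B) * (convErr d α n * qAux d (n + 1) + convErr d α (n + 1) * qAux d n))
          + A * (2 * (convErr d α n * convErr d α (n + 1))) := by
      unfold convErr
      push_cast
      linear_combination 2 * (qAux d n : ℝ) * qAux d (n + 1) * hABC
    rw [heq]
    refine (abs_add_le _ _).trans ?_
    rw [abs_neg, abs_mul, abs_mul (A : ℝ), ← hD, abs_mul 2, abs_mul (convErr d α n), abs_two]
    have h5 := mul_le_mul_of_nonneg_left ((abs_add_le _ _).trans (add_le_add h1 h2)) hD0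
    have h6 := mul_le_mul_of_nonneg_left (mul_le_one₀ h3 (abs_nonneg _) h4) hA0
    linarith
  have hint : ∀ z : ℤ, |(z : ℝ)| ≤ M → z ∈ Set.Icc (-(M : ℤ)) M := fun z hz => by
    have hz' : |z| ≤ (M : ℤ) := by exact_mod_cast hz
    exact abs_le.1 hz'
  refine Set.mem_biUnion (x := (_, _, _)) (show (_, _, _) ∈ S from
    ⟨⟨hint _ (hform (n + 1)), hint _ hbil, hint _ (hform n)⟩, fun h => ?_⟩) ?_
  · simp only [Prod.mk_eq_zero] at h
    obtain ⟨ha, hb, hc⟩ := h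
    have hdet : (pAux d (n + 1) * qAux d n - pAux d n * qAux d (n + 1) : ℤ) ^ 2 = 1 := by
      rw [pAux_mul_qAux_sub, ← pow_mul, mul_comm, pow_mul]
      simp
    apply hdisc
    generalize (pAux d (n + 1) : ℤ) = P at *
    generalize (pAux d n : ℤ) = P' at *
    generalize (qAux d (n + 1) : ℤ) = Q at *
    generalize (qAux d n : ℤ) = Q' at *
    have : (B ^ 2 - 4 * A * C) * (P * Q' - P' * Q) ^ 2 = 0 := by
      linear_combination (2 * A * P * P' + B * (P * Q' + P' * Q) + 2 * C * Q * Q') * hb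
        - 4 * (A * P' ^ 2 + B * P' * Q' + C * Q' ^ 2) * ha
    rwa [hdet, mul_one] at this
  · have h1 := convErr_ne_zero hα hd (n + 1)
    simp only [Set.mem_ofPred_eq, completeQuotient]
    field_simp
    unfold convErr
    push_cast
    linear_combination ((qAux d n : ℝ) * (qAux d (n + 1) * α - pAux d (n + 1))
      - qAux d (n + 1) * (qAux d n * α - pAux d n)) ^ 2 * hABC

theorem finiteOrbit_partialQuotients {α : ℝ} (hα0 : 0 < α) (hα1 : α < 1)
    (hquad : QuadraticIrrational α) (hd : ∀ i, 1 ≤ d (i + 1))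
    (hcf : Filter.Tendsto (fun n => (pconv d n : ℝ) / (qconv d n : ℝ)) Filter.atTop (nhds α)) :
    FiniteOrbit d := by
  have hfloor := floor_completeQuotient hquad.1 hd hcf
  have h := (finiteOrbit_of_finite_range (completeQuotient d α) (fun t => (t - ⌊t⌋₊)⁻¹)
    (fun n => by rw [completeQuotient_sub_inv hquad.1 hd, hfloor])
    (finite_range_completeQuotient hα0 hα1 hquad hd hcf)).map (fun t => ⌊t⌋₊)
  simpa only [hfloor] using h

end ContinuedFraction

theorem isAutomatic_count_digitWord {d : ℕ → ℕ} (hd : FiniteOrbit d) (a m : ℕ) [NeZero m] :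
    IsAutomatic (fun b => ((digitWord d (fun i => b.getD i 0) b.length).count a : ZMod m)) := by
  have h := (hd.linear_recurrence (m := m) (fun k => ((stdWord d k).count a : ZMod m))
    (fun n => by simp [stdWord, List.count_flatten])).isAutomatic_sum
  convert h using 2 with b
  rw [count_digitWord]
  push_cast
  rfl

theorem charWord_of_validOst {d : ℕ → ℕ} (hd0 : d 0 = 0) (hd : ∀ i, 1 ≤ d (i + 1))
    {b : List ℕ} (hb : ValidOst d b) :
    charWord d (ostVal (qconv d) b) = nextLetter d (fun i => b.getD i 0) ∧
    ∀ a, countBelow (charWord d) a (ostVal (qconv d) b)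
      = (digitWord d (fun i => b.getD i 0) b.length).count a := by
  obtain ⟨h0, hle, hz⟩ := hb
  set w := digitWord d (fun i => b.getD i 0) b.length with hw
  have hlen : w.length = ostVal (qconv d) b := by
    rw [hw, length_digitWord]
    simp only [length_stdWord hd0 hd, ostVal]
  have hout : ∀ i, b.length ≤ i → b.getD i 0 = 0 := fun i hi => by simp [hi]
  have hw2 : digitWord d (fun i => b.getD i 0) (b.length + 2) = w := by
    simp [digitWord, hw]
  have hpre := digitWord_nextLetter_prefix_stdWord (d := d) (b := fun i => b.getD i 0) h0
    (fun i => by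
      rcases lt_or_ge (i + 1) b.length with h | h
      · exact hle (i + 1) (by omega) h
      · simp only [hout _ h, zero_le])
    (fun i hi => by
      rcases lt_or_ge (i + 1) b.length with h | h
      · exact hz (i + 1) (by omega) h hi
      · simp only [hout _ h] at hi
        exact absurd hi.symm (Nat.one_le_iff_ne_zero.1 (hd (i + 1))))
    hd (b.length + 2) (by omega) (by omega)
  rw [hw2] at hpre
  obtain ⟨t, ht⟩ := hpre
  have hchar : ∀ i < (w ++ [nextLetter d (fun i => b.getD i 0)]).length, charWord d i
      = (w ++ [nextLetter d (fun i => b.getD i 0)]).getD i 0 := fun i hi => by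
    rw [charWord_eq_getD hd (k := b.length + 1) (by rw [← ht, List.length_append]; omega), ← ht,
      List.getD_append _ _ _ _ hi]
  rw [← hlen]
  refine ⟨?_, fun a => countBelow_eq_count _ _ _ fun i hi => ?_⟩
  · rw [hchar _ (by simp)]
    simp
  · rw [hchar _ (by simp; omega), List.getD_append _ _ _ _ hi]

theorem hubert_word_ostrowski_automatic (α : ℝ) (hα0 : 0 < α) (hα1 : α < 1)
    (hquad : QuadraticIrrational α) (d : ℕ → ℕ) (hd0 : d 0 = 0)
    (hd : ∀ i : ℕ, 1 ≤ d (i + 1))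
    (hcf : Filter.Tendsto (fun n => (pconv d n : ℝ) / (qconv d n : ℝ))
      Filter.atTop (nhds α))
    (p p' : ℕ) (hp : 0 < p) (hp' : 0 < p') (y y' : ℕ → ℕ)
    (hy : ∀ n : ℕ, y (n + p) = y n) (hy' : ∀ n : ℕ, y' (n + p') = y' n)
    (x : ℕ → ℕ)
    (hx : ∀ n : ℕ, x n = if charWord d n = 0 then y (countBelow (charWord d) 0 n)
      else y' (countBelow (charWord d) 1 n)) :
    ∃ (Q : Type) (_ : Fintype Q) (δ : Q → ℕ → Q) (q0 : Q) (out : Q → ℕ),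
      ∀ (n : ℕ) (b : List ℕ), ValidOst d b → ostVal (qconv d) b = n →
        out (b.foldl δ q0) = x n := by
  have : NeZero p := ⟨hp.ne'⟩
  have : NeZero p' := ⟨hp'.ne'⟩
  have hper := finiteOrbit_partialQuotients hα0 hα1 hquad hd hcf
  have hauto := (((isAutomatic_digit_eq (d 1 - 1) 0).prod (isAutomatic_digit_eq (d 2) 1)).prod
    ((isAutomatic_count_digitWord hper 0 p).prod (isAutomatic_count_digitWord hper 1 p'))).map
    (fun s => if s.1.1 = true ∧ s.1.2 = false then y' s.2.2.val else y s.2.1.val)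
  obtain ⟨Q, hQ, δ, q0, out, hF⟩ := hauto
  refine ⟨Q, hQ, δ, q0, out, ?_⟩
  rintro _ b hb rfl
  obtain ⟨hletter, hcount⟩ := charWord_of_validOst hd0 hd hb
  have hy1 : ∀ n, y (n % p) = y n := Function.Periodic.map_mod_nat hy
  have hy2 : ∀ n, y' (n % p') = y' n := Function.Periodic.map_mod_nat hy'
  have hd1 : 1 ≤ d 1 := hd 0
  have hiff : b.getD 0 0 = d 1 - 1 ↔ b.getD 0 0 + 1 = d 1 := by omega
  rw [hF, hx, hletter, hcount, hcount]
  simp only [ZMod.val_natCast, hy1, hy2, decide_eq_true_eq, decide_eq_false_iff_not, hiff,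
    nextLetter]
  split_ifs <;> simp_all
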